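/- For every semantics sem ∈ {grounded, complete, preferred, stable} and every formula φ: A ∪ S |~^∪_sem φ holds in the ABA-framework (some sem-extension contains an ABA-argument for φ) if and only if A ∪ S |~^∪_sem φ holds in the corresponding sequent-based ABA-framework (some sem-extension contains an assumptive sequent argument A' ⟨ Γ ⇒ φ with A' ⊆ A, Γ ⊆ S). -/

import Mathlib

/-- A rule `φ₁,…,φₙ → φ` of a deductive system: premises and a conclusion. -/
abbrev Rule (F : Type) := List F × F

/-- Deducibility `Γ ⊢^R φ`: chaining rules of `R` from members of `Γ`. -/
inductive Ded {F : Type} (R : Set (Rule F)) (Γ : Set F) : F → Prop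
  | mem {φ : F} : φ ∈ Γ → Ded R Γ φ
  | app {l : List F} {φ : F} : (l, φ) ∈ R → (∀ ψ ∈ l, Ded R Γ ψ) → Ded R Γ φ

/-- Derivability of assumptive sequents `A' ⟨ Γ ⇒ Δ` in the calculus `R_⇒`:
the sequents `μ(r)` for `r ∈ R`, the identity axiom, the two cut rules, and the
rules `AS_ABA` moving a formula of the assumption set `AS` between the
assumption component and the left-hand side of `⇒`. -/
inductive SeqDer {F : Type} [DecidableEq F] (R : Set (Rule F)) (AS : Set F) :
    Finset F → Finset F → Finset F → Prop
  | id (φ : F) : SeqDer R AS ∅ {φ} {φ}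
  | mu {l : List F} {φ : F} : (l, φ) ∈ R → SeqDer R AS ∅ l.toFinset {φ}
  | cutLhs {A₁ A₂ Γ₁ Γ₂ Δ₁ Δ₂ : Finset F} {φ : F} :
      SeqDer R AS A₁ Γ₁ (insert φ Δ₁) → SeqDer R AS A₂ (insert φ Γ₂) Δ₂ →
      SeqDer R AS (A₁ ∪ A₂) (Γ₁ ∪ Γ₂) (Δ₁ ∪ Δ₂)
  | cutAss {A₁ A₂ Γ₁ Γ₂ Δ₁ Δ₂ : Finset F} {φ : F} :
      SeqDer R AS A₁ Γ₁ (insert φ Δ₁) → SeqDer R AS (insert φ A₂) Γ₂ Δ₂ →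
      SeqDer R AS (A₁ ∪ A₂) (Γ₁ ∪ Γ₂) (Δ₁ ∪ Δ₂)
  | toAss {A' Γ Δ : Finset F} {φ : F} :
      φ ∈ AS → SeqDer R AS A' (insert φ Γ) Δ → SeqDer R AS (insert φ A') Γ Δ
  | toLhs {A' Γ Δ : Finset F} {φ : F} :
      φ ∈ AS → SeqDer R AS (insert φ A') Γ Δ → SeqDer R AS A' (insert φ Γ) Δ

/-- An argument: an assumption component, a support (strict premises) and a conclusion. -/
structure Argu (F : Type) where
  ass : Finset F
  supp : Finset F
  concl : F

/-- `a` is an ABA-argument based on `S` and `A`: a deduction `ass(a) ∪ supp(a) ⊢^R conc(a)`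
with finite `ass(a) ⊆ A` and finite `supp(a) ⊆ S`. -/
def IsABAArg {F : Type} (R : Set (Rule F)) (S A : Set F) (a : Argu F) : Prop :=
  ↑a.ass ⊆ A ∧ ↑a.supp ⊆ S ∧ Ded R (↑a.ass ∪ ↑a.supp) a.concl

/-- `a` is an assumptive sequent argument based on `S` and `A`: a sequent
`ass(a) ⟨ supp(a) ⇒ conc(a)` derivable in `R_⇒`, with `ass(a) ⊆ A` and `supp(a) ⊆ S`. -/
def IsSeqArg {F : Type} [DecidableEq F] (R : Set (Rule F)) (S A : Set F) (a : Argu F) : Prop :=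
  ↑a.ass ⊆ A ∧ ↑a.supp ⊆ S ∧ SeqDer R A a.ass a.supp {a.concl}

/-- `a` attacks `b` iff the conclusion of `a` is the contrary of some assumption of `b`
(this is the ABA attack, and also the sequent-based `AT_ABA` attack). -/
def Attacks {F : Type} (contrary : F → F) (a b : Argu F) : Prop :=
  ∃ ψ ∈ b.ass, a.concl = contrary ψ

/-- `E` is conflict-free: a set of arguments of the framework no member of which attacks a member. -/
def ConflictFree {α : Type} (Args : Set α) (att : α → α → Prop) (E : Set α) : Prop :=
  E ⊆ Args ∧ ∀ a ∈ E, ∀ b ∈ E, ¬ att a b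

/-- `E` defends `a`: `E` attacks every attacker of `a`. -/
def Defends {α : Type} (Args : Set α) (att : α → α → Prop) (E : Set α) (a : α) : Prop :=
  ∀ b ∈ Args, att b a → ∃ c ∈ E, att c b

/-- `E` is admissible: conflict-free and defending all of its elements. -/
def Admissible {α : Type} (Args : Set α) (att : α → α → Prop) (E : Set α) : Prop :=
  ConflictFree Args att E ∧ ∀ a ∈ E, Defends Args att E a

/-- A complete extension: an admissible set containing every argument it defends. -/
def CompleteExt {α : Type} (Args : Set α) (att : α → α → Prop) (E : Set α) : Prop :=
  Admissible Args att E ∧ ∀ a ∈ Args, Defends Args att E a → a ∈ E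

/-- The grounded extension: the ⊆-minimal complete extension. -/
def GroundedExt {α : Type} (Args : Set α) (att : α → α → Prop) (E : Set α) : Prop :=
  CompleteExt Args att E ∧ ∀ E', CompleteExt Args att E' → E ⊆ E'

/-- A preferred extension: a ⊆-maximal complete extension. -/
def PreferredExt {α : Type} (Args : Set α) (att : α → α → Prop) (E : Set α) : Prop :=
  CompleteExt Args att E ∧ ∀ E', CompleteExt Args att E' → E ⊆ E' → E' = E

/-- A set `A'` of assumptions is consistent iff there is no `φ ∈ A'` with
`A'' ∪ Γ ⊢^R φ̄` for some `A'' ⊆ A'` and `Γ ⊆ S`. -/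
def ConsistentSet {F : Type} (R : Set (Rule F)) (contrary : F → F) (S : Set F)
    (A' : Set F) : Prop :=
  ¬ ∃ φ ∈ A', ∃ A'' ⊆ A', ∃ Γ ⊆ S, Ded R (A'' ∪ Γ) (contrary φ)

/-- `MCS(S,A)`: the set of ⊆-maximal consistent subsets of `A`. -/
def MCS {F : Type} (R : Set (Rule F)) (contrary : F → F) (S A : Set F) : Set (Set F) :=
  {T | T ⊆ A ∧ ConsistentSet R contrary S T ∧
    ∀ T', T ⊆ T' → T' ⊆ A → ConsistentSet R contrary S T' → T' = T}

/-- `CN(T) = {φ | Γ ⊢^R φ for some Γ ⊆ T}`. -/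
def CN {F : Type} (R : Set (Rule F)) (T : Set F) : Set F :=
  {φ | ∃ Γ ⊆ T, Ded R Γ φ}

/-- `⊢^R` is contrapositive for assumptions: for all `φ, ψ` in an assumption set `A'`
and `Γ ⊆ S`, `A' ∪ Γ ⊢^R ψ̄` iff `(A' \ {φ}) ∪ {ψ} ∪ Γ ⊢^R φ̄`. -/
def Contrapositive {F : Type} (R : Set (Rule F)) (contrary : F → F) (S A : Set F) : Prop :=
  ∀ A' ⊆ A, ∀ Γ ⊆ S, ∀ φ ∈ A', ∀ ψ ∈ A',
    (Ded R (A' ∪ Γ) (contrary ψ) ↔ Ded R ((A' \ {φ}) ∪ {ψ} ∪ Γ) (contrary φ))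

/-- A stable extension: a complete extension attacking every argument not in it. -/
def StableExt {α : Type} (Args : Set α) (att : α → α → Prop) (E : Set α) : Prop :=
  CompleteExt Args att E ∧ ∀ a ∈ Args, a ∉ E → ∃ b ∈ E, att b a

/-- The four semantics: grounded, complete, preferred and stable. -/
inductive Sem | grd | cmp | prf | stb

/-- The extensions of a framework under a semantics. -/
def ExtOf {α : Type} (Args : Set α) (att : α → α → Prop) : Sem → Set α → Prop
  | .grd => GroundedExt Args att
  | .cmp => CompleteExt Args att
  | .prf => PreferredExt Args att
  | .stb => StableExt Args att

section Framework

variable {α : Type} {Args Args' : Set α} {att : α → α → Prop}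

/-- Every argument of `Args` is matched by one of `Args'` that is attacked by no more arguments,
and attacks no fewer. -/
def Refines (Args Args' : Set α) (att : α → α → Prop) : Prop :=
  ∀ a ∈ Args, ∃ a' ∈ Args', (∀ b, att b a' → att b a) ∧ ∀ b, att a b → att a' b

/-- The arguments of `Args` that `E` defends. -/
def defended (Args : Set α) (att : α → α → Prop) (E : Set α) : Set α :=
  {a ∈ Args | Defends Args att E a}

theorem CompleteExt.mem_of_attackers_subset {E : Set α} (hE : CompleteExt Args att E)
    {a a' : α} (ha : a ∈ E) (ha' : a' ∈ Args) (h : ∀ b, att b a' → att b a) : a' ∈ E :=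
  hE.2 a' ha' fun b hb hba => hE.1.2 a ha b hb (h b hba)

theorem Refines.defends_iff (hsub : Args' ⊆ Args) (hr : Refines Args Args' att) {E : Set α}
    {a : α} : Defends Args att E a ↔ Defends Args' att E a := by
  refine ⟨fun h b hb hba => h b (hsub hb) hba, fun h b hb hba => ?_⟩
  obtain ⟨b', hb', hin, hout⟩ := hr b hb
  obtain ⟨c, hc, hcb⟩ := h b' hb' (hout a hba)
  exact ⟨c, hc, hin c hcb⟩

theorem Refines.defends_inter (hsub : Args' ⊆ Args) (hr : Refines Args Args' att) {E : Set α}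
    (hE : CompleteExt Args att E) {a : α} (h : Defends Args att E a) :
    Defends Args att (E ∩ Args') a := by
  intro b hb hba
  obtain ⟨c, hc, hcb⟩ := h b hb hba
  obtain ⟨c', hc', hin, hout⟩ := hr c (hE.1.1.1 hc)
  exact ⟨c', ⟨hE.mem_of_attackers_subset hc (hsub hc') hin, hc'⟩, hout b hcb⟩

theorem Defends.mono {E E' : Set α} (hEE : E ⊆ E') {a : α} (h : Defends Args att E a) :
    Defends Args att E' a := fun b hb hba =>
  let ⟨c, hc, hcb⟩ := h b hb hba
  ⟨c, hEE hc, hcb⟩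

theorem CompleteExt.inter (hsub : Args' ⊆ Args) (hr : Refines Args Args' att) {E : Set α}
    (hE : CompleteExt Args att E) : CompleteExt Args' att (E ∩ Args') := by
  refine ⟨⟨⟨Set.inter_subset_right, fun a ha b hb => hE.1.1.2 a ha.1 b hb.1⟩, fun a ha => ?_⟩,
    fun a ha h => ?_⟩
  · exact (hr.defends_iff hsub).1 (hr.defends_inter hsub hE (hE.1.2 a ha.1))
  · exact ⟨hE.2 a (hsub ha) (((hr.defends_iff hsub).2 h).mono Set.inter_subset_left), ha⟩

theorem CompleteExt.subset_defended (hsub : Args' ⊆ Args) (hr : Refines Args Args' att)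
    {E : Set α} (hE : CompleteExt Args' att E) : E ⊆ defended Args att E := fun a ha =>
  ⟨hsub (hE.1.1.1 ha), (hr.defends_iff hsub).2 (hE.1.2 a ha)⟩

theorem CompleteExt.defended_inter (hsub : Args' ⊆ Args) (hr : Refines Args Args' att)
    {E : Set α} (hE : CompleteExt Args' att E) : defended Args att E ∩ Args' = E :=
  Set.Subset.antisymm (fun a ha => hE.2 a ha.2 ((hr.defends_iff hsub).1 ha.1.2))
    fun _ ha => ⟨hE.subset_defended hsub hr ha, hE.1.1.1 ha⟩

theorem CompleteExt.defended_inter_eq (hsub : Args' ⊆ Args) (hr : Refines Args Args' att)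
    {E : Set α} (hE : CompleteExt Args att E) : defended Args att (E ∩ Args') = E :=
  Set.Subset.antisymm (fun a ha => hE.2 a ha.1 (ha.2.mono Set.inter_subset_left))
    fun a ha => ⟨hE.1.1.1 ha, hr.defends_inter hsub hE (hE.1.2 a ha)⟩

theorem defended_mono {E E' : Set α} (h : E ⊆ E') : defended Args att E ⊆ defended Args att E' :=
  fun _ ha => ⟨ha.1, ha.2.mono h⟩

theorem CompleteExt.defended (hsub : Args' ⊆ Args) (hr : Refines Args Args' att)
    {E : Set α} (hE : CompleteExt Args' att E) : CompleteExt Args att (defended Args att E) := by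
  refine ⟨⟨⟨fun a ha => ha.1, fun a ha b hb hab => ?_⟩,
    fun a ha => ha.2.mono (hE.subset_defended hsub hr)⟩, fun a ha h => ⟨ha, fun b hb hba => ?_⟩⟩
  · obtain ⟨c, hc, hca⟩ := hb.2 a ha.1 hab
    obtain ⟨d, hd, hdc⟩ := ha.2 c (hsub (hE.1.1.1 hc)) hca
    exact hE.1.1.2 d hd c hc hdc
  · obtain ⟨c, hc, hcb⟩ := h b hb hba
    obtain ⟨c', hc', hin, hout⟩ := hr c hc.1
    exact ⟨c', hE.2 c' hc' fun d hd hdc => hc.2 d (hsub hd) (hin d hdc), hout b hcb⟩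

theorem ExtOf.completeExt {sem : Sem} {E : Set α} (h : ExtOf Args att sem E) :
    CompleteExt Args att E := by
  cases sem
  exacts [h.1, h, h.1, h.1]

theorem ExtOf.inter (hsub : Args' ⊆ Args) (hr : Refines Args Args' att) {sem : Sem} {E : Set α}
    (h : ExtOf Args att sem E) : ExtOf Args' att sem (E ∩ Args') := by
  have hE := h.completeExt
  have hE' := hE.inter hsub hr
  cases sem with
  | cmp => exact hE'
  | grd =>
    refine ⟨hE', fun D hD => ?_⟩
    rw [← hD.defended_inter hsub hr]
    exact Set.inter_subset_inter_left _ (h.2 _ (hD.defended hsub hr))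
  | prf =>
    refine ⟨hE', fun D hD hED => ?_⟩
    have := h.2 _ (hD.defended hsub hr) (by
      rw [← hE.defended_inter_eq hsub hr]
      exact defended_mono hED)
    rw [← this, hD.defended_inter hsub hr]
  | stb =>
    refine ⟨hE', fun a ha haE => ?_⟩
    obtain ⟨b, hb, hba⟩ := h.2 a (hsub ha) fun h' => haE ⟨h', ha⟩
    obtain ⟨b', hb', hin, hout⟩ := hr b (hE.1.1.1 hb)
    exact ⟨b', ⟨hE.mem_of_attackers_subset hb (hsub hb') hin, hb'⟩, hout a hba⟩

theorem ExtOf.defended (hsub : Args' ⊆ Args) (hr : Refines Args Args' att) {sem : Sem}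
    {E : Set α} (h : ExtOf Args' att sem E) : ExtOf Args att sem (defended Args att E) := by
  have hE := h.completeExt
  have hE' := hE.defended hsub hr
  cases sem with
  | cmp => exact hE'
  | grd =>
    refine ⟨hE', fun D hD => ?_⟩
    rw [← hD.defended_inter_eq hsub hr]
    exact defended_mono (h.2 _ (hD.inter hsub hr))
  | prf =>
    refine ⟨hE', fun D hD hED => ?_⟩
    have := h.2 _ (hD.inter hsub hr) (by
      rw [← hE.defended_inter hsub hr]
      exact Set.inter_subset_inter_left _ hED)
    rw [← this, hD.defended_inter_eq hsub hr]
  | stb =>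
    refine ⟨hE', fun a ha haE => ?_⟩
    by_contra! hna
    refine haE ⟨ha, fun b hb hba => ?_⟩
    obtain ⟨b', hb', hin, hout⟩ := hr b hb
    have hb'E : b' ∉ E := fun hbE =>
      hna b' (hE.subset_defended hsub hr hbE) (hout a hba)
    obtain ⟨c, hc, hcb⟩ := h.2 b' hb' hb'E
    exact ⟨c, hc, hin c hcb⟩

end Framework

section Deduction

variable {F : Type} {R : Set (Rule F)}

theorem Ded.cut {Γ Γ' : Set F} {φ : F} (h : Ded R Γ φ) (hΓ : ∀ ψ ∈ Γ, Ded R Γ' ψ) :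
    Ded R Γ' φ := by
  induction h with
  | mem h => exact hΓ _ h
  | app hr _ ih => exact .app hr ih

theorem Ded.mono {Γ Γ' : Set F} {φ : F} (h : Ded R Γ φ) (hΓ : Γ ⊆ Γ') : Ded R Γ' φ :=
  h.cut fun _ hψ => .mem (hΓ hψ)

variable [DecidableEq F] {AS : Set F}

/-- The formulas on the right of a derivable sequent all follow from those on the left. -/
theorem SeqDer.ded {A' Γ Δ : Finset F} (h : SeqDer R AS A' Γ Δ) :
    ∀ δ ∈ Δ, Ded R (↑A' ∪ ↑Γ) δ := by
  induction h with
  | id φ => intro δ hδ; exact .mem (by simpa using hδ)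
  | mu hr =>
    intro δ hδ
    rw [Finset.mem_singleton.1 hδ]
    exact .app hr fun ψ hψ => .mem (by simpa using hψ)
  | cutLhs _ _ ih₁ ih₂ | cutAss _ _ ih₁ ih₂ =>
    intro δ hδ
    rcases Finset.mem_union.1 hδ with hδ | hδ
    · exact (ih₁ δ (Finset.mem_insert_of_mem hδ)).mono (by intro x; simp; tauto)
    · refine (ih₂ δ hδ).cut fun ψ hψ => ?_
      by_contra h_not
      refine h_not ((ih₁ ψ (Finset.mem_insert.2 (.inl ?_))).mono (by intro x; simp; tauto))
      have hmem := mt Ded.mem h_not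
      simp only [Finset.coe_insert, Finset.coe_union, Set.mem_union, Set.mem_insert_iff]
        at hψ hmem
      tauto
  | toAss _ _ ih | toLhs _ _ ih =>
    intro δ hδ
    exact (ih δ hδ).mono (by intro x; simp; tauto)

theorem SeqDer.cut_premises {X : Set F} {φ : F} (P : Finset F)
    (hP : ∀ ψ ∈ P, ∃ T : Finset F, ↑T ⊆ X ∧ SeqDer R AS ∅ T {ψ}) (U : Finset F)
    (hU : (U : Set F) ⊆ X ∪ ↑P) (h : SeqDer R AS ∅ U {φ}) :
    ∃ T : Finset F, ↑T ⊆ X ∧ SeqDer R AS ∅ T {φ} := by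
  induction P using Finset.induction_on generalizing U with
  | empty => exact ⟨U, by simpa using hU, h⟩
  | insert ψ P _ ih =>
    have ih := ih fun χ hχ => hP χ (Finset.mem_insert_of_mem hχ)
    by_cases hψ : ψ ∈ U
    · obtain ⟨T, hT, hd⟩ := hP ψ (Finset.mem_insert_self _ _)
      refine ih (T ∪ U.erase ψ) ?_ ?_
      · intro x hx
        rcases Finset.mem_union.1 hx with hx | hx
        · exact .inl (hT hx)
        · have := hU (Finset.mem_of_mem_erase hx)
          have := Finset.ne_of_mem_erase hx
          simp_all
      · have := SeqDer.cutLhs (φ := ψ) (Δ₁ := ∅) (Γ₂ := U.erase ψ) hd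
          (by rwa [Finset.insert_erase hψ])
        simpa using this
    · refine ih U (fun x hx => ?_) h
      have := hU hx
      have : x ≠ ψ := fun hxψ => hψ (hxψ ▸ hx)
      simp_all

theorem Ded.seqDer {X : Set F} {φ : F} (h : Ded R X φ) :
    ∃ T : Finset F, ↑T ⊆ X ∧ SeqDer R AS ∅ T {φ} := by
  induction h with
  | @mem φ h => exact ⟨{φ}, by simpa using h, .id φ⟩
  | @app l φ hr _ ih =>
    exact SeqDer.cut_premises l.toFinset (fun ψ hψ => ih ψ (List.mem_toFinset.1 hψ)) _
      Set.subset_union_right (.mu hr)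

theorem SeqDer.move_to_ass {B A' Γ Δ : Finset F} (hB : ↑B ⊆ AS)
    (h : SeqDer R AS A' (B ∪ Γ) Δ) : SeqDer R AS (B ∪ A') Γ Δ := by
  induction B using Finset.induction_on generalizing A' with
  | empty => simpa using h
  | insert ψ B _ ih =>
    rw [Finset.coe_insert, Set.insert_subset_iff] at hB
    rw [Finset.insert_union] at h
    have := ih hB.2 (.toAss hB.1 h)
    rwa [Finset.union_insert, ← Finset.insert_union] at this

theorem IsSeqArg.isABAArg {S A : Set F} {a : Argu F} (h : IsSeqArg R S A a) :
    IsABAArg R S A a :=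
  ⟨h.1, h.2.1, h.2.2.ded _ (Finset.mem_singleton_self _)⟩

theorem IsABAArg.exists_isSeqArg {S A : Set F} {a : Argu F} (h : IsABAArg R S A a) :
    ∃ b, IsSeqArg R S A b ∧ b.ass ⊆ a.ass ∧ b.concl = a.concl := by
  obtain ⟨T, hT, hd⟩ := h.2.2.seqDer (AS := A)
  have hass : ((T ∩ a.ass : Finset F) : Set F) ⊆ A := fun x hx =>
    h.1 (Finset.mem_of_mem_inter_right hx)
  refine ⟨⟨T ∩ a.ass, T \ a.ass, a.concl⟩, ⟨hass, fun x hx => ?_, ?_⟩,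
    Finset.inter_subset_right, rfl⟩
  · have hx := Finset.mem_sdiff.1 hx
    exact h.2.1 ((hT hx.1).resolve_left hx.2)
  · have := SeqDer.move_to_ass (A' := ∅) (Γ := T \ a.ass) hass
      (by rwa [Finset.union_comm, Finset.sdiff_union_inter])
    simpa using this

end Deduction

/-- Credulous (∪) entailment agrees between the ABA-framework and the corresponding
sequent-based ABA-framework, under each of the four semantics: some sem-extension of
the ABA-framework contains an ABA-argument for `φ` iff some sem-extension of the
sequent-based framework contains an assumptive sequent argument `A' ⟨ Γ ⇒ φ`
with `A' ⊆ A` and `Γ ⊆ S`. -/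
theorem stmt3 {F V : Type} [DecidableEq F]
    (R : Set (Rule F)) (S A : Set F) (contrary : F → F) (atoms : F → Set V)
    (hA : A.Nonempty) (hSA : S ∩ A = ∅)
    (hNT : ∀ φ : F, (∀ s ∈ S, Disjoint (atoms φ) (atoms s)) → ¬ Ded R S φ)
    (sem : Sem) (φ : F) :
    (∃ E, ExtOf {a | IsABAArg R S A a} (Attacks contrary) sem E ∧
        ∃ a ∈ E, (a.ass : Set F) ⊆ A ∧ (a.supp : Set F) ⊆ S ∧ a.concl = φ) ↔
    (∃ E, ExtOf {a | IsSeqArg R S A a} (Attacks contrary) sem E ∧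
        ∃ a ∈ E, (a.ass : Set F) ⊆ A ∧ (a.supp : Set F) ⊆ S ∧ a.concl = φ) := by
  have hsub : {a | IsSeqArg R S A a} ⊆ {a | IsABAArg R S A a} := fun _ h => h.isABAArg
  have hr : Refines {a | IsABAArg R S A a} {a | IsSeqArg R S A a} (Attacks contrary) := by
    intro a ha
    obtain ⟨b, hb, hass, hconcl⟩ := ha.exists_isSeqArg
    exact ⟨b, hb, fun _ ⟨ψ, hψ, h⟩ => ⟨ψ, hass hψ, h⟩,
      fun _ ⟨ψ, hψ, h⟩ => ⟨ψ, hψ, hconcl.trans h⟩⟩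
  constructor
  · rintro ⟨E, hE, a, ha, _, _, rfl⟩
    obtain ⟨b, hb, hass, hconcl⟩ := (hE.completeExt.1.1.1 ha).exists_isSeqArg
    exact ⟨_, hE.inter hsub hr, b, ⟨hE.completeExt.mem_of_attackers_subset ha (hsub hb)
      fun _ ⟨ψ, hψ, h⟩ => ⟨ψ, hass hψ, h⟩, hb⟩, hb.1, hb.2.1, hconcl⟩
  · rintro ⟨E, hE, a, ha, h⟩
    exact ⟨_, hE.defended hsub hr, a, hE.completeExt.subset_defended hsub hr ha, h⟩
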